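/- arXiv:0809.4269 — 2 statements merged into one kernel-verified Lean document; each statement's English description precedes it below -/
import Mathlib

section
/- For any contravariant metric g and any two densities ρ and ρ′ on U, the quantity ν(ρ′; ρ, g) := √(ρ/ρ′)·Δ_ρ(√(ρ′/ρ)) satisfies ν(ρ′; ρ, g) = ν⁽⁰⁾_{ρ′} − ν⁽⁰⁾_ρ pointwise on U; in particular the two-cocycle ν(ρ′; ρ, g) is a coboundary. -/
/-- The `A`-th partial derivative of a function `f : ℝⁿ → ℝ`. -/
noncomputable def pd {n : ℕ} (A : Fin n) (f : (Fin n → ℝ) → ℝ) (z : Fin n → ℝ) : ℝ :=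
  fderiv ℝ f z (Pi.single A 1)

/-- The Laplacian `Δ_ρ f := (1/ρ)·Σ_{A,B} ∂_A(ρ g^{AB} ∂_B f)` associated to a density `ρ`
and a contravariant metric `g`. -/
noncomputable def lap {n : ℕ} (ρ : (Fin n → ℝ) → ℝ) (g : (Fin n → ℝ) → Fin n → Fin n → ℝ)
    (f : (Fin n → ℝ) → ℝ) (z : Fin n → ℝ) : ℝ :=
  (ρ z)⁻¹ * ∑ A, ∑ B, pd A (fun w => ρ w * g w A B * pd B f w) z

/-- `ν⁽⁰⁾_ρ := (1/√ρ)·Δ₁(√ρ)`, where `Δ₁` is the Laplacian with density `1`. -/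
noncomputable def nuZero {n : ℕ} (ρ : (Fin n → ℝ) → ℝ) (g : (Fin n → ℝ) → Fin n → Fin n → ℝ)
    (z : Fin n → ℝ) : ℝ :=
  (Real.sqrt (ρ z))⁻¹ * lap (fun _ => 1) g (fun w => Real.sqrt (ρ w)) z

theorem pd_congr {n : ℕ} {A : Fin n} {f h : (Fin n → ℝ) → ℝ} {z : Fin n → ℝ}
    (hfh : f =ᶠ[nhds z] h) : pd A f z = pd A h z := by
  unfold pd
  rw [hfh.fderiv_eq]

theorem pd_mul {n : ℕ} {A : Fin n} {f h : (Fin n → ℝ) → ℝ} {z : Fin n → ℝ}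
    (hf : DifferentiableAt ℝ f z) (hh : DifferentiableAt ℝ h z) :
    pd A (fun w => f w * h w) z = f z * pd A h z + h z * pd A f z := by
  unfold pd
  rw [fderiv_fun_mul hf hh]
  simp

theorem pd_sub {n : ℕ} {A : Fin n} {f h : (Fin n → ℝ) → ℝ} {z : Fin n → ℝ}
    (hf : DifferentiableAt ℝ f z) (hh : DifferentiableAt ℝ h z) :
    pd A (fun w => f w - h w) z = pd A f z - pd A h z := by
  unfold pd
  rw [fderiv_fun_sub hf hh]
  simp

theorem sq_mul_pd_div {n : ℕ} {A : Fin n} {f h : (Fin n → ℝ) → ℝ} {z : Fin n → ℝ}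
    (hf : DifferentiableAt ℝ f z) (hh : DifferentiableAt ℝ h z) (hz : h z ≠ 0) :
    h z ^ 2 * pd A (fun w => f w / h w) z = h z * pd A f z - f z * pd A h z := by
  have hev : f =ᶠ[nhds z] fun w => f w / h w * h w := by
    filter_upwards [hh.continuousAt.eventually_ne hz] with w hw
    rw [div_mul_cancel₀ _ hw]
  have hdiv : DifferentiableAt ℝ (fun w => f w / h w) z := by
    simpa only [div_eq_mul_inv] using hf.fun_mul (hh.fun_inv hz)
  rw [pd_congr hev, pd_mul hdiv hh]
  field_simp
  ring

theorem ContDiffAt.differentiableAt_pd {n : ℕ} {A : Fin n} {f : (Fin n → ℝ) → ℝ}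
    {z : Fin n → ℝ} (hf : ContDiffAt ℝ (⊤ : ℕ∞) f z) : DifferentiableAt ℝ (pd A f) z := by
  have h : ContDiffAt ℝ 1 (fderiv ℝ f) z :=
    hf.fderiv_right (by norm_cast)
  exact (h.differentiableAt one_ne_zero).clm_apply (differentiableAt_const _)

/-- The divergence terms of `a² ∂(b / a) = a ∂b - b ∂a`, contracted with a coefficient `G`. -/
theorem pd_sq_mul_pd_div {n : ℕ} {U : Set (Fin n → ℝ)} (hU : IsOpen U)
    {G a b : (Fin n → ℝ) → ℝ} (hG : ContDiffOn ℝ (⊤ : ℕ∞) G U)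
    (ha : ContDiffOn ℝ (⊤ : ℕ∞) a U) (hb : ContDiffOn ℝ (⊤ : ℕ∞) b U)
    (hapos : ∀ z ∈ U, a z ≠ 0) (A B : Fin n) {z : Fin n → ℝ} (hz : z ∈ U) :
    pd A (fun w => a w ^ 2 * G w * pd B (fun v => b v / a v) w) z =
      a z * pd A (fun w => G w * pd B b w) z - b z * pd A (fun w => G w * pd B a w) z
        + (G z * pd A a z * pd B b z - G z * pd B a z * pd A b z) := by
  have hnhds : ∀ w ∈ U, U ∈ nhds w := fun w hw => hU.mem_nhds hw
  have hda : ∀ w ∈ U, DifferentiableAt ℝ a w := fun w hw =>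
    (ha.contDiffAt (hnhds w hw)).differentiableAt (by simp)
  have hdb : ∀ w ∈ U, DifferentiableAt ℝ b w := fun w hw =>
    (hb.contDiffAt (hnhds w hw)).differentiableAt (by simp)
  have hdG : DifferentiableAt ℝ G z :=
    (hG.contDiffAt (hnhds z hz)).differentiableAt (by simp)
  have hGb : DifferentiableAt ℝ (fun w => G w * pd B b w) z :=
    hdG.mul (hb.contDiffAt (hnhds z hz)).differentiableAt_pd
  have hGa : DifferentiableAt ℝ (fun w => G w * pd B a w) z :=
    hdG.mul (ha.contDiffAt (hnhds z hz)).differentiableAt_pd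
  have hev : (fun w => a w ^ 2 * G w * pd B (fun v => b v / a v) w) =ᶠ[nhds z]
      fun w => a w * (G w * pd B b w) - b w * (G w * pd B a w) := by
    filter_upwards [hnhds z hz] with w hw
    linear_combination G w * sq_mul_pd_div (A := B) (hdb w hw) (hda w hw) (hapos w hw)
  rw [pd_congr hev, pd_sub ((hda z hz).fun_mul hGb) ((hdb z hz).fun_mul hGa),
    pd_mul (hda z hz) hGb, pd_mul (hdb z hz) hGa]
  ring

/-- for any contravariant metric `g` and densities `ρ, ρ′` on an open set `U`,
`ν(ρ′; ρ, g) := √(ρ/ρ′)·Δ_ρ(√(ρ′/ρ)) = ν⁽⁰⁾_{ρ′} − ν⁽⁰⁾_ρ` pointwise on `U`;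
in particular the two-cocycle `ν(ρ′; ρ, g)` is a coboundary. -/
theorem stmt0 {n : ℕ} (U : Set (Fin n → ℝ)) (hU : IsOpen U)
    (g : (Fin n → ℝ) → Fin n → Fin n → ℝ)
    (hg : ∀ A B, ContDiffOn ℝ (⊤ : ℕ∞) (fun z => g z A B) U)
    (hgsymm : ∀ z ∈ U, ∀ A B, g z A B = g z B A)
    (ρ ρ' : (Fin n → ℝ) → ℝ)
    (hρ : ContDiffOn ℝ (⊤ : ℕ∞) ρ U) (hρpos : ∀ z ∈ U, 0 < ρ z)
    (hρ' : ContDiffOn ℝ (⊤ : ℕ∞) ρ' U) (hρ'pos : ∀ z ∈ U, 0 < ρ' z) :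
    ∀ z ∈ U,
      Real.sqrt (ρ z / ρ' z) * lap ρ g (fun w => Real.sqrt (ρ' w / ρ w)) z
        = nuZero ρ' g z - nuZero ρ g z := by
  intro z hz
  have hsqrt : ∀ r : (Fin n → ℝ) → ℝ, ContDiffOn ℝ (⊤ : ℕ∞) r U → (∀ w ∈ U, 0 < r w) →
      ContDiffOn ℝ (⊤ : ℕ∞) (fun w => Real.sqrt (r w)) U :=
    fun r hr hpos => hr.sqrt fun w hw => (hpos w hw).ne'
  have ha := hsqrt ρ hρ hρpos
  have hb := hsqrt ρ' hρ' hρ'pos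
  have hane : ∀ w ∈ U, Real.sqrt (ρ w) ≠ 0 := fun w hw => (Real.sqrt_pos.2 (hρpos w hw)).ne'
  have hterm : ∀ A B, pd A (fun w => ρ w * g w A B *
      pd B (fun v => Real.sqrt (ρ' v / ρ v)) w) z = _ := fun A B =>
    (pd_congr (by
      filter_upwards [hU.mem_nhds hz] with w hw
      rw [Real.sq_sqrt (hρpos w hw).le]
      congr 1
      apply pd_congr
      filter_upwards [hU.mem_nhds hw] with v hv
      exact Real.sqrt_div (hρ'pos v hv).le _)).trans
      (pd_sq_mul_pd_div hU (hg A B) ha hb hane A B hz)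
  have hcancel : ∑ A, ∑ B,
      (g z A B * pd A (fun w => Real.sqrt (ρ w)) z * pd B (fun w => Real.sqrt (ρ' w)) z
        - g z A B * pd B (fun w => Real.sqrt (ρ w)) z * pd A (fun w => Real.sqrt (ρ' w)) z)
      = 0 := by
    simp only [Finset.sum_sub_distrib]
    rw [sub_eq_zero, Finset.sum_comm]
    refine Finset.sum_congr rfl fun A _ => Finset.sum_congr rfl fun B _ => ?_
    rw [hgsymm z hz B A]
  have hsum : ∑ A, ∑ B, pd A (fun w => ρ w * g w A B *
      pd B (fun v => Real.sqrt (ρ' v / ρ v)) w) z =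
      Real.sqrt (ρ z) * (∑ A, ∑ B, pd A (fun w => g w A B *
        pd B (fun v => Real.sqrt (ρ' v)) w) z) -
      Real.sqrt (ρ' z) * (∑ A, ∑ B, pd A (fun w => g w A B *
        pd B (fun v => Real.sqrt (ρ v)) w) z) := by
    simp only [hterm]
    simp only [Finset.sum_add_distrib] at hcancel ⊢
    rw [hcancel, add_zero]
    simp only [Finset.sum_sub_distrib, Finset.mul_sum]
  have ha0 := hane z hz
  have hb0 : Real.sqrt (ρ' z) ≠ 0 := (Real.sqrt_pos.2 (hρ'pos z hz)).ne'
  have hinv : (ρ z)⁻¹ = (Real.sqrt (ρ z) ^ 2)⁻¹ := by rw [Real.sq_sqrt (hρpos z hz).le]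
  simp only [nuZero, lap, one_mul, inv_one]
  rw [hsum, Real.sqrt_div (hρpos z hz).le, hinv]
  field_simp
end

section
/- Clifford contraction of a tensor with Riemann symmetries reduces to its scalar contraction: if R : Fin n → Fin n → Fin n → Fin n → ℝ satisfies (i) R a b c d = −R b a c d, (ii) R a b c d = −R a b d c, and (iii) the first Bianchi identity R a b c d + R b c a d + R c a b d = 0, then in Cl_λ(n) one has Σ_{a,b,c,d} R a b c d · (γ_a·γ_b·γ_c·γ_d) = (−2λ²·Σ_{a,b} R a b a b)·1. -/
open CliffordAlgebra

section CliffordRelations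

variable {I K A : Type*} [Fintype I] [DecidableEq I] [Field K] [CharZero K] [Ring A] [Algebra K A]

/-- Contracting a symmetric tensor with two Clifford generators gives its trace. -/
theorem sum_smul_mul_of_symm {lam : K} {γ : I → A}
    (hγ : ∀ a b, γ a * γ b + γ b * γ a = (if a = b then 2 * lam else 0) • (1 : A))
    {S : I → I → K} (hS : ∀ a b, S a b = S b a) :
    ∑ a, ∑ b, S a b • (γ a * γ b) = (lam * ∑ a, S a a) • (1 : A) := by
  have hswap : ∑ a, ∑ b, S a b • (γ b * γ a) = ∑ a, ∑ b, S a b • (γ a * γ b) := by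
    rw [Finset.sum_comm]
    simp only [hS]
  have hsum : ∑ a, ∑ b, S a b • (γ a * γ b) + ∑ a, ∑ b, S a b • (γ b * γ a)
      = (2 * (lam * ∑ a, S a a)) • (1 : A) := by
    simp only [← Finset.sum_add_distrib, ← smul_add, hγ, smul_smul, ite_smul,
      zero_smul, smul_ite, smul_zero, Finset.sum_ite_eq, Finset.mem_univ, if_true,
      Finset.mul_sum, Finset.sum_smul]
    exact Finset.sum_congr rfl fun a _ => by congr 1; ring
  rw [hswap, ← two_smul K, mul_smul] at hsum
  exact smul_right_injective A (two_ne_zero (α := K)) hsum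

/-- Contracting a tensor satisfying the Bianchi identity with three Clifford generators gives its
Ricci-type trace. -/
theorem sum_smul_mul_mul_of_bianchi {lam : K} {γ : I → A}
    (hγ : ∀ a b, γ a * γ b + γ b * γ a = (if a = b then 2 * lam else 0) • (1 : A))
    {S : I → I → I → K} (hanti : ∀ a b c, S a b c = -S b a c)
    (hbianchi : ∀ a b c, S a b c + S b c a + S c a b = 0) :
    ∑ a, ∑ b, ∑ c, S a b c • (γ a * γ b * γ c)
      = (-2 * lam) • ∑ b, (∑ a, S a b a) • γ b := by
  have hdiag : ∀ a c, S a a c = 0 := fun a c => self_eq_neg.mp (hanti a a c)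
  have hcyc₁ : ∑ a, ∑ b, ∑ c, S a b c • (γ c * γ a * γ b)
      = ∑ a, ∑ b, ∑ c, S b c a • (γ a * γ b * γ c) := by
    rw [Finset.sum_congr rfl fun a _ => Finset.sum_comm, Finset.sum_comm]
  have hcyc₂ : ∑ a, ∑ b, ∑ c, S a b c • (γ b * γ c * γ a)
      = ∑ a, ∑ b, ∑ c, S c a b • (γ a * γ b * γ c) := by
    rw [Finset.sum_comm, Finset.sum_congr rfl fun a _ => Finset.sum_comm]
  have hzero : ∑ a, ∑ b, ∑ c,
      S a b c • (γ a * γ b * γ c + γ b * γ c * γ a + γ c * γ a * γ b) = 0 := by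
    simp only [smul_add, Finset.sum_add_distrib, hcyc₁, hcyc₂]
    simp only [← Finset.sum_add_distrib, ← add_smul]
    refine Finset.sum_eq_zero fun a _ => Finset.sum_eq_zero fun b _ =>
      Finset.sum_eq_zero fun c _ => ?_
    rw [add_right_comm, hbianchi, zero_smul]
  have hexpand : ∀ a b c, γ a * γ b * γ c + γ b * γ c * γ a + γ c * γ a * γ b
      = (3 : K) • (γ a * γ b * γ c) + (2 : K) • (if c = a then 2 * lam else 0) • γ b
        - (if b = c then 2 * lam else 0) • γ a - (if a = b then 2 * lam else 0) • γ c := by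
    intro a b c
    have h₁ : (if c = a then 2 * lam else 0) • γ b = (γ c * γ a + γ a * γ c) * γ b := by
      rw [hγ, smul_one_mul]
    have h₁' : (if c = a then 2 * lam else 0) • γ b = γ b * (γ c * γ a + γ a * γ c) := by
      rw [hγ, mul_smul_one]
    have h₂ : (if b = c then 2 * lam else 0) • γ a = γ a * (γ b * γ c + γ c * γ b) := by
      rw [hγ, mul_smul_one]
    have h₃ : (if a = b then 2 * lam else 0) • γ c = (γ a * γ b + γ b * γ a) * γ c := by
      rw [hγ, smul_one_mul]
    rw [two_smul, h₂, h₃]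
    nth_rewrite 1 [h₁]
    rw [h₁', show (3 : K) = 1 + 1 + 1 by norm_num, add_smul, add_smul, one_smul]
    noncomm_ring
  have htrace₁ : ∑ a, ∑ b, ∑ c, S a b c • (2 : K) • (if c = a then 2 * lam else 0) • γ b
      = (4 * lam) • ∑ b, (∑ a, S a b a) • γ b := by
    rw [Finset.sum_comm]
    simp only [smul_smul, ite_smul, zero_smul, smul_ite, smul_zero, Finset.sum_ite_eq',
      Finset.mem_univ, if_true, Finset.smul_sum, Finset.sum_smul]
    exact Finset.sum_congr rfl fun b _ => Finset.sum_congr rfl fun a _ => by congr 1; ring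
  have htrace₂ : ∑ a, ∑ b, ∑ c, S a b c • (if b = c then 2 * lam else 0) • γ a
      = (-2 * lam) • ∑ b, (∑ a, S a b a) • γ b := by
    simp only [smul_smul, ite_smul, zero_smul, smul_ite, smul_zero, Finset.sum_ite_eq,
      Finset.mem_univ, if_true, Finset.smul_sum, Finset.sum_smul]
    exact Finset.sum_congr rfl fun a _ => Finset.sum_congr rfl fun b _ => by
      rw [hanti a b b]; congr 1; ring
  have htrace₃ : ∑ a, ∑ b, ∑ c, S a b c • (if a = b then 2 * lam else 0) • γ c = 0 := by
    refine Finset.sum_eq_zero fun a _ => Finset.sum_eq_zero fun b _ =>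
      Finset.sum_eq_zero fun c _ => ?_
    split_ifs with h
    · rw [← h, hdiag, zero_smul]
    · rw [zero_smul, smul_zero]
  simp only [hexpand, smul_sub, smul_add, Finset.sum_sub_distrib, Finset.sum_add_distrib,
    htrace₁, htrace₂, htrace₃, sub_zero] at hzero
  simp only [smul_comm _ (3 : K), ← Finset.smul_sum] at hzero
  refine smul_right_injective A (three_ne_zero : (3 : K) ≠ 0) ?_
  dsimp only
  rw [add_sub_assoc, ← sub_smul] at hzero
  rw [eq_neg_of_add_eq_zero_left hzero, smul_smul, ← neg_smul]
  congr 1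
  ring

end CliffordRelations

/-- A tensor with the Riemann symmetries is symmetric under exchange of its index pairs. -/
theorem pair_symm_of_bianchi {I K : Type*} [Field K] [CharZero K] {R : I → I → I → I → K}
    (hanti1 : ∀ a b c d, R a b c d = -R b a c d)
    (hanti2 : ∀ a b c d, R a b c d = -R a b d c)
    (hbianchi : ∀ a b c d, R a b c d + R b c a d + R c a b d = 0) (a b c d : I) :
    R a b c d = R c d a b := by
  grind

/-- The Clifford relations for the standard basis of Euclidean space. -/
theorem CliffordAlgebra.ι_single_mul_add_swap {I : Type*} [Fintype I] [DecidableEq I] {lam : ℝ}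
    {Q : QuadraticForm ℝ (EuclideanSpace ℝ I)} (hQ : ∀ x, Q x = lam * ‖x‖ ^ 2) (a b : I) :
    ι Q (EuclideanSpace.single a (1 : ℝ)) * ι Q (EuclideanSpace.single b 1)
        + ι Q (EuclideanSpace.single b 1) * ι Q (EuclideanSpace.single a 1)
      = (if a = b then 2 * lam else 0) • (1 : CliffordAlgebra Q) := by
  rw [ι_mul_ι_add_swap, Algebra.algebraMap_eq_smul_one, QuadraticMap.polar, hQ, hQ, hQ,
    norm_add_sq_real]
  congr 1
  split_ifs with h
  all_goals
    simp [h, EuclideanSpace.inner_single_left]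
    ring

/-- Clifford contraction of a tensor with Riemann symmetries reduces to its
scalar contraction.  Here `Cl_λ(n)` is the Clifford algebra of the quadratic form
`x ↦ λ·‖x‖²` on Euclidean `ℝⁿ`, and `γ_a` is the image of the `a`-th standard basis vector,
so that `γ_a·γ_b + γ_b·γ_a = 2λδ_{ab}·1`.  If `R` is antisymmetric in its first and last
index pairs and satisfies the first Bianchi identity, then
`Σ_{a,b,c,d} R a b c d · (γ_a γ_b γ_c γ_d) = (−2λ²·Σ_{a,b} R a b a b)·1`. -/
theorem stmt16 {n : ℕ} (lam : ℝ)
    (Q : QuadraticForm ℝ (EuclideanSpace ℝ (Fin n)))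
    (hQ : ∀ x, Q x = lam * ‖x‖ ^ 2)
    (R : Fin n → Fin n → Fin n → Fin n → ℝ)
    (hanti1 : ∀ a b c d, R a b c d = -R b a c d)
    (hanti2 : ∀ a b c d, R a b c d = -R a b d c)
    (hbianchi : ∀ a b c d, R a b c d + R b c a d + R c a b d = 0) :
    ∑ a, ∑ b, ∑ c, ∑ d,
        R a b c d •
          (ι Q (EuclideanSpace.single a (1 : ℝ)) * ι Q (EuclideanSpace.single b 1)
            * ι Q (EuclideanSpace.single c 1) * ι Q (EuclideanSpace.single d 1))
      = (-2 * lam ^ 2 * ∑ a, ∑ b, R a b a b) • (1 : CliffordAlgebra Q) := by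
  have hγ := ι_single_mul_add_swap hQ
  have hcubic (d : Fin n) := sum_smul_mul_mul_of_bianchi hγ
    (fun a b c => hanti1 a b c d) (fun a b c => hbianchi a b c d)
  have hric (b d : Fin n) : ∑ a, R a b a d = ∑ a, R a d a b :=
    Finset.sum_congr rfl fun a _ => pair_symm_of_bianchi hanti1 hanti2 hbianchi a b a d
  have hquad := sum_smul_mul_of_symm hγ hric
  calc
    _ = ∑ d, (∑ a, ∑ b, ∑ c, R a b c d • (ι Q (EuclideanSpace.single a (1 : ℝ))
          * ι Q (EuclideanSpace.single b 1) * ι Q (EuclideanSpace.single c 1)))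
          * ι Q (EuclideanSpace.single d 1) := by
      simp only [Finset.sum_mul, smul_mul_assoc]
      symm
      rw [Finset.sum_comm]
      refine Finset.sum_congr rfl fun a _ => ?_
      rw [Finset.sum_comm]
      exact Finset.sum_congr rfl fun b _ => Finset.sum_comm
    _ = (-2 * lam) • ∑ b, ∑ d, (∑ a, R a b a d) • (ι Q (EuclideanSpace.single b (1 : ℝ))
          * ι Q (EuclideanSpace.single d 1)) := by
      simp only [hcubic, smul_mul_assoc, Finset.sum_mul, ← Finset.smul_sum]
      rw [Finset.sum_comm]
    _ = _ := by
      rw [hquad, smul_smul, Finset.sum_comm (f := fun a b => R a b a b)]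
      congr 1
      ring
end
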